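/- For every positive integer p, with q = 2p+1 one has A_{2p+1} − (1/2^(4p))·B(8p+5, 8p+5) < π < A_{2p+1} − (1/2^(4p+1))·B(8p+5, 8p+5), where B(8p+5, 8p+5) = ((8p+4)!)²/(16p+9)!. -/

import Mathlib

open Real

lemma beta_nat_aux (n : ℕ) : (∫ x in (0:ℝ)..1, x ^ n * (1 - x) ^ n) =
    (Nat.factorial n : ℝ) ^ 2 / (Nat.factorial (2 * n + 1) : ℝ) := by
  have hpos : 0 < ((n : ℂ) + 1).re := by
    simp only [Complex.add_re, Complex.natCast_re, Complex.one_re]; positivity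
  have h := Complex.betaIntegral_eq_Gamma_mul_div ((n : ℂ) + 1) ((n : ℂ) + 1) hpos hpos
  have e : (n : ℂ) + 1 + ((n : ℂ) + 1) = ((2 * n + 1 : ℕ) : ℂ) + 1 := by push_cast; ring
  rw [e, Complex.Gamma_nat_eq_factorial, Complex.Gamma_nat_eq_factorial] at h
  unfold Complex.betaIntegral at h
  simp only [add_sub_cancel_right, Complex.cpow_natCast] at h
  have h2 : ((∫ x in (0:ℝ)..1, x ^ n * (1 - x) ^ n : ℝ) : ℂ) =
      (((Nat.factorial n : ℝ) ^ 2 / (Nat.factorial (2 * n + 1) : ℝ) : ℝ) : ℂ) := by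
    rw [← intervalIntegral.integral_ofReal]
    push_cast
    rw [h, sq]
  exact_mod_cast h2

lemma integral_split_aux (n : ℕ) (c : ℝ) :
    (∫ x in (0:ℝ)..1, (4 + c * x ^ n * (1 - x) ^ n) / (x ^ 2 + 1)) =
      π + c * ∫ x in (0:ℝ)..1, x ^ n * (1 - x) ^ n / (x ^ 2 + 1) := by
  have hne : ∀ x : ℝ, x ^ 2 + 1 ≠ 0 := fun x => by positivity
  have e : ∀ x : ℝ, (4 + c * x ^ n * (1 - x) ^ n) / (x ^ 2 + 1) =
      4 * (1 / (1 + x ^ 2)) + c * (x ^ n * (1 - x) ^ n / (x ^ 2 + 1)) := by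
    intro x
    rw [add_comm 1 (x ^ 2)]
    ring
  simp only [e]
  rw [intervalIntegral.integral_add, intervalIntegral.integral_const_mul,
    intervalIntegral.integral_const_mul, integral_one_div_one_add_sq]
  · simp
    ring
  · apply Continuous.intervalIntegrable
    have : ∀ x : ℝ, 1 + x ^ 2 ≠ 0 := fun x => by positivity
    fun_prop (disch := assumption)
  · apply Continuous.intervalIntegrable
    fun_prop (disch := assumption)

lemma bounds_aux (n : ℕ) (hn : n ≠ 0) :
    (∫ x in (0:ℝ)..1, x ^ n * (1 - x) ^ n / (x ^ 2 + 1)) < (∫ x in (0:ℝ)..1, x ^ n * (1 - x) ^ n) ∧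
    (∫ x in (0:ℝ)..1, x ^ n * (1 - x) ^ n) / 2 < ∫ x in (0:ℝ)..1, x ^ n * (1 - x) ^ n / (x ^ 2 + 1) := by
  have hne : ∀ x : ℝ, x ^ 2 + 1 ≠ 0 := fun x => by positivity
  have c1 : Continuous fun x : ℝ => x ^ n * (1 - x) ^ n / (x ^ 2 + 1) := by
    fun_prop (disch := assumption)
  have c2 : Continuous fun x : ℝ => x ^ n * (1 - x) ^ n := by fun_prop
  have hnn : ∀ x ∈ Set.Ioc (0:ℝ) 1, 0 ≤ x ^ n * (1 - x) ^ n := fun x hx =>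
    mul_nonneg (pow_nonneg hx.1.le _) (pow_nonneg (by linarith [hx.2]) _)
  have hp : (0:ℝ) < (1/2) ^ n * (1 - 1/2) ^ n := by norm_num
  constructor
  · apply intervalIntegral.integral_lt_integral_of_continuousOn_of_le_of_exists_lt one_pos
      c1.continuousOn c2.continuousOn
    · intro x hx
      exact div_le_self (hnn x hx) (by nlinarith [sq_nonneg x])
    · refine ⟨1/2, by norm_num, ?_⟩
      exact div_lt_self hp (by norm_num)
  · rw [← intervalIntegral.integral_div]
    apply intervalIntegral.integral_lt_integral_of_continuousOn_of_le_of_exists_lt one_pos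
      (c2.div_const 2).continuousOn c1.continuousOn
    · intro x hx
      exact div_le_div_of_nonneg_left (hnn x hx) (by positivity) (by nlinarith [hx.1, hx.2])
    · refine ⟨1/2, by norm_num, ?_⟩
      exact div_lt_div_of_pos_left hp (by norm_num) (by norm_num)

theorem odd_case_bounds (p : ℕ) (hp : 0 < p) :
    (∫ x in (0:ℝ)..1,
        (4 + (-1/4 : ℝ) ^ (2 * p + 1 - 1) * x ^ (4 * (2 * p + 1)) * (1 - x) ^ (4 * (2 * p + 1))) / (x ^ 2 + 1)) -
        (1 / 2 ^ (4 * p)) * ((Nat.factorial (8 * p + 4) : ℝ) ^ 2 / (Nat.factorial (16 * p + 9) : ℝ)) < π ∧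
      π < (∫ x in (0:ℝ)..1,
        (4 + (-1/4 : ℝ) ^ (2 * p + 1 - 1) * x ^ (4 * (2 * p + 1)) * (1 - x) ^ (4 * (2 * p + 1))) / (x ^ 2 + 1)) -
        (1 / 2 ^ (4 * p + 1)) * ((Nat.factorial (8 * p + 4) : ℝ) ^ 2 / (Nat.factorial (16 * p + 9) : ℝ)) := by
  have hc : (-1/4 : ℝ) ^ (2 * p + 1 - 1) = 1 / 2 ^ (4 * p) := by
    rw [Nat.add_sub_cancel, pow_mul, pow_mul, ← one_div_pow]
    norm_num
  rw [integral_split_aux, hc]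
  have hb := beta_nat_aux (8 * p + 4)
  rw [show 2 * (8 * p + 4) + 1 = 16 * p + 9 by ring] at hb
  rw [← hb, show 4 * (2 * p + 1) = 8 * p + 4 by ring, pow_succ (2:ℝ) (4 * p)]
  obtain ⟨h1, h2⟩ := bounds_aux (8 * p + 4) (by omega)
  have hk : (0:ℝ) < 1 / 2 ^ (4 * p) := by positivity
  rw [← one_div_mul_one_div (2 ^ (4 * p) : ℝ) 2]
  have h3 := mul_lt_mul_of_pos_left h1 hk
  have h4 := mul_lt_mul_of_pos_left h2 hk
  constructor <;> linarith
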